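/- arXiv:1606.04589 — 6 statements merged into one kernel-verified Lean document; each statement's English description precedes it below -/
import Mathlib

section
/- Weak representation theorem for ES basic fusion operators: an ES combination operator ∇ on an epistemic space (ℰ, B, ℒ_𝒫) is an ES basic fusion operator (i.e., satisfies (ESF1)–(ESF4)) if and only if there exists a unique basic assignment Φ ↦ ≽_Φ that represents ∇, i.e., such that [B(∇(Φ,E))] = max([B(E)], ≽_Φ) for every profile Φ and every epistemic state E. -/
/- Common framework for logic-based merging of epistemic states
   (Mata Díaz & Pino Pérez, "Impossibility in Belief Merging"). -/

namespace BeliefMerging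

/-- A profile: a nonempty finite society of agents together with an
assignment of an epistemic state to each agent of the society. -/
structure Profile (S ℰ : Type) where
  soc : Finset S
  soc_nonempty : soc.Nonempty
  val : {x // x ∈ soc} → ℰ

variable {S ℰ W : Type}

/-- The singleton profile of agent `i` with epistemic state `E`. -/
def Profile.single (i : S) (E : ℰ) : Profile S ℰ :=
  ⟨{i}, Finset.singleton_nonempty i, fun _ => E⟩

/-- Restriction of a profile to a nonempty subsociety. -/
def Profile.restrict (Φ : Profile S ℰ) (M : Finset S) (hM : M.Nonempty)
    (hsub : M ⊆ Φ.soc) : Profile S ℰ :=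
  ⟨M, hM, fun i => Φ.val ⟨i.1, hsub i.2⟩⟩

/-- Equivalence of profiles: societies of the same cardinality whose states
correspond under the unique order-preserving bijection. -/
def Profile.Equiv [LinearOrder S] (Φ Ψ : Profile S ℰ) : Prop :=
  ∃ h : Φ.soc.card = Ψ.soc.card,
    ∀ k : Fin Φ.soc.card,
      Φ.val (Φ.soc.orderIsoOfFin rfl k) = Ψ.val (Ψ.soc.orderIsoOfFin h.symm k)

/-- (ESF1) -/
def ESF1 (B : ℰ → Set W) (nab : Profile S ℰ → ℰ → ℰ) : Prop :=
  ∀ (Φ : Profile S ℰ) (E : ℰ), B (nab Φ E) ⊆ B E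

/-- (ESF2) -/
def ESF2 [LinearOrder S] (B : ℰ → Set W) (nab : Profile S ℰ → ℰ → ℰ) : Prop :=
  ∀ (Φ Φ' : Profile S ℰ) (E E' : ℰ), Profile.Equiv Φ Φ' → B E = B E' →
    B (nab Φ E) = B (nab Φ' E')

/-- (ESF3) -/
def ESF3 (B : ℰ → Set W) (nab : Profile S ℰ → ℰ → ℰ) : Prop :=
  ∀ (Φ : Profile S ℰ) (E E' E'' : ℰ), B E = B E' ∩ B E'' →
    B (nab Φ E') ∩ B E'' ⊆ B (nab Φ E)

/-- (ESF4) -/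
def ESF4 (B : ℰ → Set W) (nab : Profile S ℰ → ℰ → ℰ) : Prop :=
  ∀ (Φ : Profile S ℰ) (E E' E'' : ℰ), B E = B E' ∩ B E'' →
    (B (nab Φ E') ∩ B E'').Nonempty →
    B (nab Φ E) ⊆ B (nab Φ E') ∩ B E''

/-- ES basic fusion operator: (ESF1)–(ESF4). -/
def BasicFusion [LinearOrder S] (B : ℰ → Set W) (nab : Profile S ℰ → ℰ → ℰ) : Prop :=
  ESF1 B nab ∧ ESF2 B nab ∧ ESF3 B nab ∧ ESF4 B nab

/-- (ESF5) -/
def ESF5 (B : ℰ → Set W) (nab : Profile S ℰ → ℰ → ℰ) : Prop :=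
  ∀ (j k : S) (Ej Ek : ℰ), Ej ≠ Ek →
    ∃ E' : ℰ, B (nab (Profile.single j Ej) E') ≠ B (nab (Profile.single k Ek) E')

/-- (ESF6) -/
def ESF6 (B : ℰ → Set W) (nab : Profile S ℰ → ℰ → ℰ) : Prop :=
  ∀ (Φ : Profile S ℰ) (E : ℰ),
    ((⋂ i : {x // x ∈ Φ.soc}, B (Φ.val i)) ∩ B E).Nonempty →
    B (nab Φ E) = (⋂ i : {x // x ∈ Φ.soc}, B (Φ.val i)) ∩ B E

/-- (ESF7) -/
def ESF7 [DecidableEq S] (B : ℰ → Set W) (nab : Profile S ℰ → ℰ → ℰ) : Prop :=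
  ∀ (Φ : Profile S ℰ) (N₁ N₂ : Finset S) (h₁ : N₁.Nonempty) (h₂ : N₂.Nonempty)
    (hs₁ : N₁ ⊆ Φ.soc) (hs₂ : N₂ ⊆ Φ.soc),
    Disjoint N₁ N₂ → N₁ ∪ N₂ = Φ.soc → ∀ E : ℰ,
      B (nab (Φ.restrict N₁ h₁ hs₁) E) ∩ B (nab (Φ.restrict N₂ h₂ hs₂) E) ⊆
        B (nab Φ E)

/-- (ESF8) -/
def ESF8 [DecidableEq S] (B : ℰ → Set W) (nab : Profile S ℰ → ℰ → ℰ) : Prop :=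
  ∀ (Φ : Profile S ℰ) (N₁ N₂ : Finset S) (h₁ : N₁.Nonempty) (h₂ : N₂.Nonempty)
    (hs₁ : N₁ ⊆ Φ.soc) (hs₂ : N₂ ⊆ Φ.soc),
    Disjoint N₁ N₂ → N₁ ∪ N₂ = Φ.soc → ∀ E : ℰ,
      (B (nab (Φ.restrict N₁ h₁ hs₁) E) ∩ B (nab (Φ.restrict N₂ h₂ hs₂) E)).Nonempty →
      B (nab Φ E) ⊆
        B (nab (Φ.restrict N₁ h₁ hs₁) E) ∩ B (nab (Φ.restrict N₂ h₂ hs₂) E)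

/-- (ESF8W) -/
def ESF8W [DecidableEq S] (B : ℰ → Set W) (nab : Profile S ℰ → ℰ → ℰ) : Prop :=
  ∀ (Φ : Profile S ℰ) (N₁ N₂ : Finset S) (h₁ : N₁.Nonempty) (h₂ : N₂.Nonempty)
    (hs₁ : N₁ ⊆ Φ.soc) (hs₂ : N₂ ⊆ Φ.soc),
    Disjoint N₁ N₂ → N₁ ∪ N₂ = Φ.soc → ∀ E : ℰ,
      (B (nab (Φ.restrict N₁ h₁ hs₁) E) ∩ B (nab (Φ.restrict N₂ h₂ hs₂) E)).Nonempty →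
      B (nab Φ E) ⊆
        B (nab (Φ.restrict N₁ h₁ hs₁) E) ∪ B (nab (Φ.restrict N₂ h₂ hs₂) E)

/-- ES fusion operator: (ESF1)–(ESF8). -/
def Fusion [LinearOrder S] (B : ℰ → Set W) (nab : Profile S ℰ → ℰ → ℰ) : Prop :=
  BasicFusion B nab ∧ ESF5 B nab ∧ ESF6 B nab ∧ ESF7 B nab ∧ ESF8 B nab

/-- ES quasifusion operator: (ESF1)–(ESF7) and (ESF8W). -/
def Quasifusion [LinearOrder S] (B : ℰ → Set W) (nab : Profile S ℰ → ℰ → ℰ) : Prop :=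
  BasicFusion B nab ∧ ESF5 B nab ∧ ESF6 B nab ∧ ESF7 B nab ∧ ESF8W B nab

/-- (ESF-SD), Standard Domain. -/
def ESFSD (B : ℰ → Set W) (nab : Profile S ℰ → ℰ → ℰ) : Prop :=
  ∀ (i : S) (w w' w'' : W), w ≠ w' → w ≠ w'' → w' ≠ w'' →
  ∀ (E₁ E₂ : ℰ), B E₁ = {w, w'} → B E₂ = {w', w''} →
    (∃ Ei : ℰ, B (nab (Profile.single i Ei) E₁) = {w, w'} ∧
               B (nab (Profile.single i Ei) E₂) = {w', w''}) ∧
    (∃ Ei : ℰ, B (nab (Profile.single i Ei) E₁) = {w, w'} ∧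
               B (nab (Profile.single i Ei) E₂) = {w'}) ∧
    (∃ Ei : ℰ, B (nab (Profile.single i Ei) E₁) = {w} ∧
               B (nab (Profile.single i Ei) E₂) = {w', w''}) ∧
    (∃ Ei : ℰ, B (nab (Profile.single i Ei) E₁) = {w} ∧
               B (nab (Profile.single i Ei) E₂) = {w'})

/-- (ESF-U), Unanimity. -/
def ESFU (B : ℰ → Set W) (nab : Profile S ℰ → ℰ → ℰ) : Prop :=
  ∀ (Φ : Profile S ℰ), (∀ i j : {x // x ∈ Φ.soc}, Φ.val i = Φ.val j) →
    ∀ (E : ℰ) (i : {x // x ∈ Φ.soc}),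
      B (nab Φ E) = B (nab (Profile.single i.1 (Φ.val i)) E)

/-- (ESF-P), Pareto. -/
def ESFP (B : ℰ → Set W) (nab : Profile S ℰ → ℰ → ℰ) : Prop :=
  ∀ (Φ : Profile S ℰ) (E E' : ℰ),
    (⋂ i : {x // x ∈ Φ.soc}, B (nab (Profile.single i.1 (Φ.val i)) E)).Nonempty →
    (∀ i : {x // x ∈ Φ.soc}, B (nab (Profile.single i.1 (Φ.val i)) E) ∩ B E' = ∅) →
    B (nab Φ E) ∩ B E' = ∅

/-- (ESF-I), Independence. -/
def ESFI (B : ℰ → Set W) (nab : Profile S ℰ → ℰ → ℰ) : Prop :=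
  ∀ (N : Finset S) (hN : N.Nonempty) (f g : {x // x ∈ N} → ℰ) (E : ℰ),
    (∀ E' : ℰ, B E' ⊆ B E → ∀ j : {x // x ∈ N},
      B (nab (Profile.single j.1 (f j)) E') = B (nab (Profile.single j.1 (g j)) E')) →
    B (nab ⟨N, hN, f⟩ E) = B (nab ⟨N, hN, g⟩ E)

/-- (ESF-D), Dictator. -/
def ESFD (B : ℰ → Set W) (nab : Profile S ℰ → ℰ → ℰ) : Prop :=
  ∀ (N : Finset S) (hN : N.Nonempty), ∃ d : {x // x ∈ N},
    ∀ (f : {x // x ∈ N} → ℰ) (E : ℰ),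
      B (nab ⟨N, hN, f⟩ E) ⊆ B (nab (Profile.single d.1 (f d)) E)

/-- The maximal elements of `C` with respect to the total preorder `R`. -/
def MaxSet (C : Set W) (R : W → W → Prop) : Set W :=
  {w ∈ C | ∀ w' ∈ C, R w w'}

/-- The strict part of a total preorder. -/
def StrictRel (R : W → W → Prop) (a b : W) : Prop := R a b ∧ ¬ R b a

/-- An assignment: each profile is mapped to a total preorder over valuations. -/
def IsAssignment (f : Profile S ℰ → W → W → Prop) : Prop :=
  ∀ Φ : Profile S ℰ, (∀ a b : W, f Φ a b ∨ f Φ b a) ∧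
    (∀ a b c : W, f Φ a b → f Φ b c → f Φ a c)

/-- A basic assignment: an assignment sending equivalent profiles to equal preorders. -/
def IsBasicAssignment [LinearOrder S] (f : Profile S ℰ → W → W → Prop) : Prop :=
  IsAssignment f ∧ ∀ Φ Ψ : Profile S ℰ, Profile.Equiv Φ Ψ → f Φ = f Ψ

/-- The assignment `f` represents the operator `nab`. -/
def Represents (B : ℰ → Set W) (nab : Profile S ℰ → ℰ → ℰ)
    (f : Profile S ℰ → W → W → Prop) : Prop :=
  ∀ (Φ : Profile S ℰ) (E : ℰ), B (nab Φ E) = MaxSet (B E) (f Φ)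

/-- Property 1. -/
def Prop1 (f : Profile S ℰ → W → W → Prop) : Prop :=
  ∀ (j k : S) (Ej Ek : ℰ), Ej ≠ Ek →
    f (Profile.single j Ej) ≠ f (Profile.single k Ek)

/-- Property 2. -/
def Prop2 (B : ℰ → Set W) (f : Profile S ℰ → W → W → Prop) : Prop :=
  ∀ Φ : Profile S ℰ, (⋂ i : {x // x ∈ Φ.soc}, B (Φ.val i)).Nonempty →
    (⋂ i : {x // x ∈ Φ.soc}, B (Φ.val i)) = MaxSet Set.univ (f Φ)

/-- Property 3. -/
def Prop3 [DecidableEq S] (f : Profile S ℰ → W → W → Prop) : Prop :=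
  ∀ (Φ : Profile S ℰ) (N₁ N₂ : Finset S) (h₁ : N₁.Nonempty) (h₂ : N₂.Nonempty)
    (hs₁ : N₁ ⊆ Φ.soc) (hs₂ : N₂ ⊆ Φ.soc),
    Disjoint N₁ N₂ → N₁ ∪ N₂ = Φ.soc → ∀ w w' : W,
      f (Φ.restrict N₁ h₁ hs₁) w w' → f (Φ.restrict N₂ h₂ hs₂) w w' → f Φ w w'

/-- Property 4. -/
def Prop4 [DecidableEq S] (f : Profile S ℰ → W → W → Prop) : Prop :=
  ∀ (Φ : Profile S ℰ) (N₁ N₂ : Finset S) (h₁ : N₁.Nonempty) (h₂ : N₂.Nonempty)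
    (hs₁ : N₁ ⊆ Φ.soc) (hs₂ : N₂ ⊆ Φ.soc),
    Disjoint N₁ N₂ → N₁ ∪ N₂ = Φ.soc → ∀ w w' : W,
      f (Φ.restrict N₁ h₁ hs₁) w w' → StrictRel (f (Φ.restrict N₂ h₂ hs₂)) w w' →
        StrictRel (f Φ) w w'

/-- Property 4′. -/
def Prop4' [DecidableEq S] (f : Profile S ℰ → W → W → Prop) : Prop :=
  ∀ (Φ : Profile S ℰ) (N₁ N₂ : Finset S) (h₁ : N₁.Nonempty) (h₂ : N₂.Nonempty)
    (hs₁ : N₁ ⊆ Φ.soc) (hs₂ : N₂ ⊆ Φ.soc),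
    Disjoint N₁ N₂ → N₁ ∪ N₂ = Φ.soc → ∀ w w' : W,
      StrictRel (f (Φ.restrict N₁ h₁ hs₁)) w w' →
      StrictRel (f (Φ.restrict N₂ h₂ hs₂)) w w' →
        StrictRel (f Φ) w w'

/-- The Maximality Condition. -/
def Maximality (B : ℰ → Set W) (f : Profile S ℰ → W → W → Prop) : Prop :=
  ∀ (i : S) (E : ℰ), B E = MaxSet Set.univ (f (Profile.single i E))

/-- Faithful assignment: basic + Properties 1–4. -/
def IsFaithfulAssignment [LinearOrder S] (B : ℰ → Set W)
    (f : Profile S ℰ → W → W → Prop) : Prop :=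
  IsBasicAssignment f ∧ Prop1 f ∧ Prop2 B f ∧ Prop3 f ∧ Prop4 f

/-- Quasifaithful assignment: basic + Properties 1–3 and 4′. -/
def IsQuasifaithfulAssignment [LinearOrder S] (B : ℰ → Set W)
    (f : Profile S ℰ → W → W → Prop) : Prop :=
  IsBasicAssignment f ∧ Prop1 f ∧ Prop2 B f ∧ Prop3 f ∧ Prop4' f

/-- Property (u). -/
def PropU (f : Profile S ℰ → W → W → Prop) : Prop :=
  ∀ (Φ : Profile S ℰ), (∀ i j : {x // x ∈ Φ.soc}, Φ.val i = Φ.val j) →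
    ∀ i : {x // x ∈ Φ.soc}, f Φ = f (Profile.single i.1 (Φ.val i))

/-- Property (p). -/
def PropP (f : Profile S ℰ → W → W → Prop) : Prop :=
  ∀ (Φ : Profile S ℰ) (w w' : W),
    (∀ i : {x // x ∈ Φ.soc}, StrictRel (f (Profile.single i.1 (Φ.val i))) w w') →
    StrictRel (f Φ) w w'

/-- Two relations coincide on the pair `{w, w'}`. -/
def SameOnPair (R R' : W → W → Prop) (w w' : W) : Prop :=
  (R w w' ↔ R' w w') ∧ (R w' w ↔ R' w' w)

/-- Property (ind). -/
def PropInd (f : Profile S ℰ → W → W → Prop) : Prop :=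
  ∀ (N : Finset S) (hN : N.Nonempty) (g g' : {x // x ∈ N} → ℰ) (w w' : W),
    (∀ i : {x // x ∈ N},
      SameOnPair (f (Profile.single i.1 (g i))) (f (Profile.single i.1 (g' i))) w w') →
    SameOnPair (f ⟨N, hN, g⟩) (f ⟨N, hN, g'⟩) w w'

/-- Property (d). -/
def PropD (f : Profile S ℰ → W → W → Prop) : Prop :=
  ∀ (N : Finset S) (hN : N.Nonempty), ∃ d : {x // x ∈ N},
    ∀ (g : {x // x ∈ N} → ℰ) (w w' : W),
      StrictRel (f (Profile.single d.1 (g d))) w w' → StrictRel (f ⟨N, hN, g⟩) w w'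

/-- `D` is a locally decisive `N`-coalition for `E` against `E'`. -/
def LocallyDecisiveFor (B : ℰ → Set W) (nab : Profile S ℰ → ℰ → ℰ)
    (N : Finset S) (hN : N.Nonempty) (D : Finset S) (hD : D ⊆ N) (E E' : ℰ) : Prop :=
  ∀ f : {x // x ∈ N} → ℰ,
    (∀ i : {x // x ∈ D}, B (nab (Profile.single i.1 (f ⟨i.1, hD i.2⟩)) E) ∩ B E' = ∅) →
    (∀ j : {x // x ∈ N}, j.1 ∉ D → B (nab (Profile.single j.1 (f j)) E) = B E') →
    (⋂ i : {x // x ∈ D}, B (nab (Profile.single i.1 (f ⟨i.1, hD i.2⟩)) E)).Nonempty →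
    B (nab ⟨N, hN, f⟩ E) ∩ B E' = ∅

/-- `D` is a decisive `N`-coalition for `E` against `E'`. -/
def DecisiveFor (B : ℰ → Set W) (nab : Profile S ℰ → ℰ → ℰ)
    (N : Finset S) (hN : N.Nonempty) (D : Finset S) (hD : D ⊆ N) (E E' : ℰ) : Prop :=
  ∀ f : {x // x ∈ N} → ℰ,
    (∀ i : {x // x ∈ D}, B (nab (Profile.single i.1 (f ⟨i.1, hD i.2⟩)) E) ∩ B E' = ∅) →
    (⋂ i : {x // x ∈ D}, B (nab (Profile.single i.1 (f ⟨i.1, hD i.2⟩)) E)).Nonempty →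
    B (nab ⟨N, hN, f⟩ E) ∩ B E' = ∅

/-- `D` is a decisive `N`-coalition. -/
def DecisiveCoalition (B : ℰ → Set W) (nab : Profile S ℰ → ℰ → ℰ)
    (N : Finset S) (hN : N.Nonempty) (D : Finset S) (hD : D ⊆ N) : Prop :=
  ∀ E E' : ℰ, DecisiveFor B nab N hN D hD E E'

end BeliefMerging

namespace BeliefMerging

variable {S ℰ W : Type} {B : ℰ → Set W} {nab : Profile S ℰ → ℰ → ℰ}

theorem mem_maxSet_pair_iff {R : W → W → Prop} (hR : ∀ a, R a a) {a b : W} :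
    a ∈ MaxSet {a, b} R ↔ R a b := by
  simp [MaxSet, hR a]

theorem ESF3.mem_of_pair (h3 : ESF3 B nab) {Φ : Profile S ℰ} {E P : ℰ} {a b : W}
    (hP : B P = {a, b}) (ha : a ∈ B E) (hb : b ∈ B E) (h : a ∈ B (nab Φ E)) :
    a ∈ B (nab Φ P) := by
  refine h3 Φ P E P ?_ ⟨h, by simp [hP]⟩
  rw [hP, Set.inter_eq_self_of_subset_right (Set.pair_subset ha hb)]

theorem ESF4.mem_of_mem_pair (h4 : ESF4 B nab) {Φ : Profile S ℰ} {E P : ℰ} {a b : W}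
    (hP : B P = {a, b}) (ha : a ∈ B E) (hb : b ∈ B E) (h : a ∈ B (nab Φ P))
    (hbE : b ∈ B (nab Φ E)) : a ∈ B (nab Φ E) := by
  refine (h4 Φ P E P ?_ ⟨b, hbE, by simp [hP]⟩ h).1
  rw [hP, Set.inter_eq_self_of_subset_right (Set.pair_subset ha hb)]

/-- An operator representable by a basic assignment is a basic fusion operator. -/
theorem Represents.basicFusion [LinearOrder S] {f : Profile S ℰ → W → W → Prop}
    (hf : IsBasicAssignment f) (hrep : Represents B nab f) : BasicFusion B nab := by
  refine ⟨fun Φ E w hw => ?_, fun Φ Φ' E E' hΦ hE => ?_, fun Φ E E' E'' hE w hw => ?_,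
    fun Φ E E' E'' hE hne w hw => ?_⟩
  · rw [hrep] at hw
    exact hw.1
  · rw [hrep, hrep, hf.2 Φ Φ' hΦ, hE]
  · rw [hrep] at hw ⊢
    rw [hE]
    exact ⟨⟨hw.1.1, hw.2⟩, fun w' hw' => hw.1.2 w' hw'.1⟩
  · obtain ⟨v, hv, hv''⟩ := hne
    rw [hrep] at hw hv ⊢
    rw [hE] at hw
    exact ⟨⟨hw.1.1, fun w' hw' =>
      (hf.1 Φ).2 w v w' (hw.2 v ⟨hv.1, hv''⟩) (hv.2 w' hw')⟩, hw.1.2⟩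

/-- The relation revealed by the choices of `nab` on the states `P a b`. -/
def revealed (B : ℰ → Set W) (nab : Profile S ℰ → ℰ → ℰ) (P : W → W → ℰ)
    (Φ : Profile S ℰ) (a b : W) : Prop :=
  a ∈ B (nab Φ (P a b))

theorem BasicFusion.isBasicAssignment_revealed [LinearOrder S] (hB : ∀ E, (B E).Nonempty)
    (hsurj : ∀ A : Set W, A.Nonempty → ∃ E, B E = A) {P : W → W → ℰ}
    (hP : ∀ a b, B (P a b) = {a, b}) (h : BasicFusion B nab) :
    IsBasicAssignment (revealed B nab P) := by
  obtain ⟨h1, h2, h3, h4⟩ := h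
  refine ⟨fun Φ => ⟨fun a b => ?_, fun a b c hab hbc => ?_⟩, fun Φ Ψ hΦ => ?_⟩
  · obtain ⟨d, hd⟩ := hB (nab Φ (P a b))
    have hd' := h1 _ _ hd
    rw [hP] at hd'
    rcases hd' with rfl | rfl
    · exact Or.inl hd
    · exact Or.inr (h3.mem_of_pair (hP _ _) (by simp [hP]) (by simp [hP]) hd)
  · obtain ⟨E, hE⟩ := hsurj {a, b, c} ⟨a, by simp⟩
    have ha : a ∈ B E := by simp [hE]
    have hb : b ∈ B E := by simp [hE]
    have hc : c ∈ B E := by simp [hE]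
    have hba : b ∈ B (nab Φ E) → a ∈ B (nab Φ E) := h4.mem_of_mem_pair (hP a b) ha hb hab
    have hcb : c ∈ B (nab Φ E) → b ∈ B (nab Φ E) := h4.mem_of_mem_pair (hP b c) hb hc hbc
    refine h3.mem_of_pair (hP a c) ha hc ?_
    obtain ⟨d, hd⟩ := hB (nab Φ E)
    have hd' := h1 _ _ hd
    rw [hE] at hd'
    rcases hd' with rfl | rfl | rfl
    · exact hd
    · exact hba hd
    · exact hba (hcb hd)
  · funext a b
    simp only [revealed, h2 Φ Ψ (P a b) (P a b) hΦ rfl]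

theorem BasicFusion.represents_revealed [LinearOrder S] (hB : ∀ E, (B E).Nonempty)
    {P : W → W → ℰ} (hP : ∀ a b, B (P a b) = {a, b}) (h : BasicFusion B nab) :
    Represents B nab (revealed B nab P) := by
  obtain ⟨h1, -, h3, h4⟩ := h
  intro Φ E
  ext w
  constructor
  · intro hw
    exact ⟨h1 _ _ hw, fun w' hw' => h3.mem_of_pair (hP w w') (h1 _ _ hw) hw' hw⟩
  · rintro ⟨hw, hmax⟩
    obtain ⟨d, hd⟩ := hB (nab Φ E)
    have hdE := h1 _ _ hd
    exact h4.mem_of_mem_pair (hP w d) hw hdE (hmax d hdE) hd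

theorem Represents.eq_revealed {P : W → W → ℰ} (hP : ∀ a b, B (P a b) = {a, b})
    {f : Profile S ℰ → W → W → Prop} (hf : IsAssignment f) (hrep : Represents B nab f) :
    f = revealed B nab P := by
  funext Φ a b
  rw [revealed, hrep, hP, mem_maxSet_pair_iff fun a => or_self_iff.mp ((hf Φ).1 a a)]

end BeliefMerging

open BeliefMerging in
/-- Weak representation theorem for ES basic fusion operators. -/
theorem weak_representation_basic_fusion
    {S ℰ W : Type} [LinearOrder S] [Nonempty S] [Fintype W] [Nonempty W]
    (B : ℰ → Set W) (hB : ∀ E : ℰ, (B E).Nonempty)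
    (hsurj : ∀ A : Set W, A.Nonempty → ∃ E : ℰ, B E = A)
    (nab : Profile S ℰ → ℰ → ℰ) :
    BasicFusion B nab ↔
      ∃! f : Profile S ℰ → W → W → Prop,
        IsBasicAssignment f ∧ Represents B nab f := by
  constructor
  · intro h
    choose P hP using fun a b : W => hsurj {a, b} ⟨a, by simp⟩
    exact ⟨revealed B nab P,
      ⟨h.isBasicAssignment_revealed hB hsurj hP, h.represents_revealed hB hP⟩,
      fun f hf => hf.2.eq_revealed hP hf.1.1⟩
  · rintro ⟨f, ⟨hf, hrep⟩, -⟩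
    exact hrep.basicFusion hf
end

section
/- Let Φ ↦ ≽_Φ be an assignment satisfying Properties 3 and 4. Then the assignment satisfies Property 2 if and only if it satisfies the Maximality Condition. -/
namespace BeliefMerging

theorem Profile.restrict_singleton {S ℰ : Type} (Φ : Profile S ℰ) (a : S)
    (h : ({a} : Finset S).Nonempty) (hs : {a} ⊆ Φ.soc) :
    Φ.restrict {a} h hs =
      Profile.single a (Φ.val ⟨a, hs (Finset.mem_singleton_self a)⟩) := by
  unfold Profile.restrict Profile.single
  congr 1
  funext ⟨x, hx⟩
  obtain rfl := Finset.mem_singleton.1 hx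
  rfl

/-- Pareto principle, weak and strong form: a profile respects every weak preference shared by
all of its agents, strictly so as soon as one agent's preference is strict. -/
theorem pareto_of_prop3_of_prop4 {S ℰ W : Type} [DecidableEq S]
    {f : Profile S ℰ → W → W → Prop} (h3 : Prop3 f) (h4 : Prop4 f) (Φ : Profile S ℰ) {w w' : W}
    (hw : ∀ i : {x // x ∈ Φ.soc}, f (Profile.single i.1 (Φ.val i)) w w') :
    f Φ w w' ∧ ((∃ i : {x // x ∈ Φ.soc}, StrictRel (f (Profile.single i.1 (Φ.val i))) w w') →
      StrictRel (f Φ) w w') := by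
  obtain ⟨N, hN, g⟩ := Φ
  induction hN using Finset.Nonempty.cons_induction with
  | singleton a =>
    have hΦ : (⟨{a}, Finset.singleton_nonempty a, g⟩ : Profile S ℰ) =
        Profile.single a (g ⟨a, Finset.mem_singleton_self a⟩) :=
      Profile.restrict_singleton ⟨{a}, Finset.singleton_nonempty a, g⟩ a
        (Finset.singleton_nonempty a) subset_rfl
    rw [hΦ]
    refine ⟨hw ⟨a, Finset.mem_singleton_self a⟩, ?_⟩
    rintro ⟨⟨i, hi⟩, hstrict⟩
    obtain rfl := Finset.mem_singleton.1 hi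
    exact hstrict
  | cons a s ha hs ih =>
    have hsa : {a} ⊆ Finset.cons a s ha := by simp
    have hss : s ⊆ Finset.cons a s ha := Finset.subset_cons ha
    have hdisj : Disjoint {a} s := Finset.disjoint_singleton_left.2 ha
    have hunion : {a} ∪ s = Finset.cons a s ha := by simp
    set Φ : Profile S ℰ := ⟨Finset.cons a s ha, Finset.cons_nonempty ha, g⟩
    have hsingle := Profile.restrict_singleton Φ a (Finset.singleton_nonempty a) hsa
    obtain ⟨hweak, hstrong⟩ := ih (fun i => g ⟨i.1, hss i.2⟩) fun i => hw ⟨i.1, hss i.2⟩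
    have hwa : f (Φ.restrict {a} (Finset.singleton_nonempty a) hsa) w w' :=
      hsingle ▸ hw ⟨a, hsa (Finset.mem_singleton_self a)⟩
    refine ⟨h3 Φ {a} s (Finset.singleton_nonempty a) hs hsa hss hdisj hunion w w' hwa hweak, ?_⟩
    rintro ⟨⟨i, hi⟩, hstrict⟩
    rcases (Finset.mem_cons (h := ha)).1 hi with rfl | his
    · exact h4 Φ s {i} hs (Finset.singleton_nonempty i) hss hsa hdisj.symm
        (Finset.union_comm s {i} ▸ hunion) w w' hweak (hsingle ▸ hstrict)
    · exact h4 Φ {a} s (Finset.singleton_nonempty a) hs hsa hss hdisj hunion w w' hwa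
        (hstrong ⟨⟨i, his⟩, hstrict⟩)

theorem Prop2.maximality {S ℰ W : Type} {B : ℰ → Set W} {f : Profile S ℰ → W → W → Prop}
    (hB : ∀ E : ℰ, (B E).Nonempty) (h2 : Prop2 B f) : Maximality B f := by
  intro i E
  have hinter : (⋂ _j : {x // x ∈ (Profile.single i E).soc}, B E) = B E :=
    haveI : Nonempty {x // x ∈ (Profile.single i E).soc} := ⟨⟨i, Finset.mem_singleton_self i⟩⟩
    Set.iInter_const (B E)
  exact hinter.symm.trans (h2 (Profile.single i E) (hinter.symm ▸ hB E))

theorem Maximality.prop2 {S ℰ W : Type} [DecidableEq S] {B : ℰ → Set W}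
    {f : Profile S ℰ → W → W → Prop} (hf : IsAssignment f) (h3 : Prop3 f) (h4 : Prop4 f)
    (hmax : Maximality B f) : Prop2 B f := by
  intro Φ hne
  have hle : ∀ w ∈ ⋂ i : {x // x ∈ Φ.soc}, B (Φ.val i), ∀ (w' : W) (i : {x // x ∈ Φ.soc}),
      f (Profile.single i.1 (Φ.val i)) w w' := by
    intro w hw w' i
    have hwi := Set.mem_iInter.1 hw i
    rw [hmax i.1 (Φ.val i)] at hwi
    exact hwi.2 w' (Set.mem_univ w')
  refine Set.Subset.antisymm (fun w hw => ⟨Set.mem_univ w, fun w' _ =>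
    (pareto_of_prop3_of_prop4 h3 h4 Φ (hle w hw w')).1⟩) fun w hw => ?_
  obtain ⟨v, hv⟩ := hne
  refine Set.mem_iInter.2 fun i => ?_
  by_contra hwi
  have hstrict : StrictRel (f (Profile.single i.1 (Φ.val i))) v w := by
    refine ⟨hle v hv w i, fun hwv => hwi ?_⟩
    rw [hmax i.1 (Φ.val i)]
    exact ⟨Set.mem_univ w, fun u _ => (hf _).2 w v u hwv (hle v hv u i)⟩
  exact ((pareto_of_prop3_of_prop4 h3 h4 Φ (hle v hv w)).2 ⟨i, hstrict⟩).2
    (hw.2 v (Set.mem_univ v))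

end BeliefMerging

open BeliefMerging in
/-- Under Properties 3 and 4, Property 2 is equivalent to the Maximality Condition. -/
theorem prop2_iff_maximality
    {S ℰ W : Type} [LinearOrder S] [Nonempty S] [Fintype W] [Nonempty W]
    (B : ℰ → Set W) (hB : ∀ E : ℰ, (B E).Nonempty)
    (hsurj : ∀ A : Set W, A.Nonempty → ∃ E : ℰ, B E = A)
    (f : Profile S ℰ → W → W → Prop) (hf : IsAssignment f)
    (h3 : Prop3 f) (h4 : Prop4 f) :
    Prop2 B f ↔ Maximality B f := by
  exact ⟨Prop2.maximality hB, Maximality.prop2 hf h3 h4⟩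
end

section
/- Let ∇ be an ES basic fusion operator and let Φ ↦ ≽_Φ be the unique basic assignment representing ∇. Then: (i) ∇ satisfies (ESF5) iff the assignment satisfies Property 1; (ii) ∇ satisfies (ESF6) iff the assignment satisfies Property 2; (iii) ∇ satisfies (ESF7) iff the assignment satisfies Property 3; (iv) ∇ satisfies (ESF8) iff the assignment satisfies Property 4; (v) ∇ satisfies (ESF8W) iff the assignment satisfies Property 4′. -/
namespace BeliefMerging

variable {S ℰ W : Type}

theorem mem_maxSet_pair {R : W → W → Prop} (hR : ∀ a b, R a b ∨ R b a) {w w' : W} :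
    w ∈ MaxSet {w, w'} R ↔ R w w' := by
  refine ⟨fun h => h.2 w' (by simp), fun h => ⟨by simp, ?_⟩⟩
  rintro v (rfl | rfl)
  · exact (hR v v).elim id id
  · exact h

theorem mem_maxSet_pair_right {R : W → W → Prop} (hR : ∀ a b, R a b ∨ R b a) {w w' : W} :
    w' ∈ MaxSet {w, w'} R ↔ R w' w := by
  rw [Set.pair_comm, mem_maxSet_pair hR]

theorem mem_maxSet_of_rel {R : W → W → Prop} (hR : ∀ a b c, R a b → R b c → R a c)
    {C : Set W} {x y : W} (hx : x ∈ MaxSet C R) (hy : y ∈ C) (hyx : R y x) :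
    y ∈ MaxSet C R :=
  ⟨hy, fun z hz => hR y x z hyx (hx.2 z hz)⟩

theorem strictRel_of_notMem_maxSet {R : W → W → Prop}
    (hR : ∀ a b c, R a b → R b c → R a c) {C : Set W} {x y : W} (hx : x ∈ MaxSet C R)
    (hy : y ∈ C) (hy' : y ∉ MaxSet C R) : StrictRel R x y :=
  ⟨hx.2 y hy, fun hyx => hy' (mem_maxSet_of_rel hR hx hy hyx)⟩

theorem maxSet_eq_maxSet_univ_inter {R : W → W → Prop}
    (hR : ∀ a b c, R a b → R b c → R a c) {C : Set W}
    (h : (MaxSet Set.univ R ∩ C).Nonempty) : MaxSet C R = MaxSet Set.univ R ∩ C := by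
  obtain ⟨x, hx, hxC⟩ := h
  ext y
  constructor
  · intro hy
    exact ⟨mem_maxSet_of_rel hR hx (Set.mem_univ y) (hy.2 x hxC), hy.1⟩
  · rintro ⟨hy, hyC⟩
    exact ⟨hyC, fun z _ => hy.2 z (Set.mem_univ z)⟩

theorem strictRel_of_pair {R : W → W → Prop} (hR : ∀ a b, R a b ∨ R b a) {w w' : W}
    (h : w' ∉ MaxSet {w, w'} R) : StrictRel R w w' := by
  rw [mem_maxSet_pair_right hR] at h
  exact ⟨(hR w w').resolve_right h, h⟩

section Correspondence

variable {B : ℰ → Set W} {nab : Profile S ℰ → ℰ → ℰ} {f : Profile S ℰ → W → W → Prop}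

theorem esf5_iff_prop1 (hsurj : ∀ A : Set W, A.Nonempty → ∃ E : ℰ, B E = A)
    (hf : IsAssignment f) (hrep : Represents B nab f) : ESF5 B nab ↔ Prop1 f := by
  constructor
  · intro h j k Ej Ek hne heq
    obtain ⟨E', hE'⟩ := h j k Ej Ek hne
    exact hE' (by rw [hrep, hrep, heq])
  · intro h j k Ej Ek hne
    by_contra! hall
    refine h j k Ej Ek hne ?_
    funext w w'
    obtain ⟨E, hE⟩ := hsurj {w, w'} (by simp)
    have hEq := hall E
    rw [hrep, hrep, hE] at hEq
    rw [← mem_maxSet_pair (hf _).1, hEq, mem_maxSet_pair (hf _).1]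

theorem esf6_iff_prop2 [Nonempty W] (hsurj : ∀ A : Set W, A.Nonempty → ∃ E : ℰ, B E = A)
    (hf : IsAssignment f) (hrep : Represents B nab f) : ESF6 B nab ↔ Prop2 B f := by
  constructor
  · intro h Φ hne
    obtain ⟨E, hE⟩ := hsurj Set.univ Set.univ_nonempty
    have := h Φ E (by simpa [hE] using hne)
    rw [hrep, hE, Set.inter_univ] at this
    exact this.symm
  · intro h Φ E hne
    have hmax := h Φ (hne.mono Set.inter_subset_left)
    rw [hmax] at hne ⊢
    rw [hrep, maxSet_eq_maxSet_univ_inter (hf Φ).2 hne]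

theorem esf7_iff_prop3 [DecidableEq S]
    (hsurj : ∀ A : Set W, A.Nonempty → ∃ E : ℰ, B E = A)
    (hf : IsAssignment f) (hrep : Represents B nab f) : ESF7 B nab ↔ Prop3 f := by
  constructor
  · intro h Φ N₁ N₂ h₁ h₂ hs₁ hs₂ hd hu w w' hw₁ hw₂
    obtain ⟨E, hE⟩ := hsurj {w, w'} (by simp)
    have hsub := h Φ N₁ N₂ h₁ h₂ hs₁ hs₂ hd hu E
    rw [hrep, hrep, hrep, hE] at hsub
    exact (mem_maxSet_pair (hf _).1).1
      (hsub ⟨(mem_maxSet_pair (hf _).1).2 hw₁, (mem_maxSet_pair (hf _).1).2 hw₂⟩)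
  · intro h Φ N₁ N₂ h₁ h₂ hs₁ hs₂ hd hu E
    rw [hrep, hrep, hrep]
    rintro x ⟨hx₁, hx₂⟩
    exact ⟨hx₁.1, fun y hy =>
      h Φ N₁ N₂ h₁ h₂ hs₁ hs₂ hd hu x y (hx₁.2 y hy) (hx₂.2 y hy)⟩

theorem esf8_iff_prop4 [DecidableEq S]
    (hsurj : ∀ A : Set W, A.Nonempty → ∃ E : ℰ, B E = A)
    (hf : IsAssignment f) (hrep : Represents B nab f) : ESF8 B nab ↔ Prop4 f := by
  constructor
  · intro h Φ N₁ N₂ h₁ h₂ hs₁ hs₂ hd hu w w' hw₁ hw₂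
    obtain ⟨E, hE⟩ := hsurj {w, w'} (by simp)
    have hsub := h Φ N₁ N₂ h₁ h₂ hs₁ hs₂ hd hu E
    rw [hrep, hrep, hrep, hE] at hsub
    refine strictRel_of_pair (hf Φ).1 fun hw' => hw₂.2 ?_
    exact (mem_maxSet_pair_right (hf _).1).1 (hsub
      ⟨w, (mem_maxSet_pair (hf _).1).2 hw₁, (mem_maxSet_pair (hf _).1).2 hw₂.1⟩ hw').2
  · intro h Φ N₁ N₂ h₁ h₂ hs₁ hs₂ hd hu E
    rw [hrep, hrep, hrep]
    rintro ⟨x, hx₁, hx₂⟩ y hy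
    constructor
    · by_contra hy'
      exact (h Φ N₂ N₁ h₂ h₁ hs₂ hs₁ hd.symm (by rw [Finset.union_comm, hu]) x y
        (hx₂.2 y hy.1) (strictRel_of_notMem_maxSet (hf _).2 hx₁ hy.1 hy')).2 (hy.2 x hx₁.1)
    · by_contra hy'
      exact (h Φ N₁ N₂ h₁ h₂ hs₁ hs₂ hd hu x y
        (hx₁.2 y hy.1) (strictRel_of_notMem_maxSet (hf _).2 hx₂ hy.1 hy')).2 (hy.2 x hx₁.1)

theorem esf8W_iff_prop4' [DecidableEq S]
    (hsurj : ∀ A : Set W, A.Nonempty → ∃ E : ℰ, B E = A)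
    (hf : IsAssignment f) (hrep : Represents B nab f) : ESF8W B nab ↔ Prop4' f := by
  constructor
  · intro h Φ N₁ N₂ h₁ h₂ hs₁ hs₂ hd hu w w' hw₁ hw₂
    obtain ⟨E, hE⟩ := hsurj {w, w'} (by simp)
    have hsub := h Φ N₁ N₂ h₁ h₂ hs₁ hs₂ hd hu E
    rw [hrep, hrep, hrep, hE] at hsub
    refine strictRel_of_pair (hf Φ).1 fun hw' => ?_
    rcases hsub ⟨w, (mem_maxSet_pair (hf _).1).2 hw₁.1,
      (mem_maxSet_pair (hf _).1).2 hw₂.1⟩ hw' with hm | hm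
    · exact hw₁.2 ((mem_maxSet_pair_right (hf _).1).1 hm)
    · exact hw₂.2 ((mem_maxSet_pair_right (hf _).1).1 hm)
  · intro h Φ N₁ N₂ h₁ h₂ hs₁ hs₂ hd hu E
    rw [hrep, hrep, hrep]
    rintro ⟨x, hx₁, hx₂⟩ y hy
    by_contra hy'
    rw [Set.mem_union, not_or] at hy'
    exact (h Φ N₁ N₂ h₁ h₂ hs₁ hs₂ hd hu x y
      (strictRel_of_notMem_maxSet (hf _).2 hx₁ hy.1 hy'.1)
      (strictRel_of_notMem_maxSet (hf _).2 hx₂ hy.1 hy'.2)).2 (hy.2 x hx₁.1)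

end Correspondence

end BeliefMerging

open BeliefMerging in
/-- Correspondence between postulates (ESF5)-(ESF8W) and Properties 1-4′ of the
representing basic assignment. -/
theorem postulates_iff_properties
    {S ℰ W : Type} [LinearOrder S] [Nonempty S] [Fintype W] [Nonempty W]
    (B : ℰ → Set W) (hB : ∀ E : ℰ, (B E).Nonempty)
    (hsurj : ∀ A : Set W, A.Nonempty → ∃ E : ℰ, B E = A)
    (nab : Profile S ℰ → ℰ → ℰ) (hbf : BasicFusion B nab)
    (f : Profile S ℰ → W → W → Prop)
    (hf : IsBasicAssignment f) (hrep : Represents B nab f) :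
    (ESF5 B nab ↔ Prop1 f) ∧
    (ESF6 B nab ↔ Prop2 B f) ∧
    (ESF7 B nab ↔ Prop3 f) ∧
    (ESF8 B nab ↔ Prop4 f) ∧
    (ESF8W B nab ↔ Prop4' f) := by
  exact ⟨esf5_iff_prop1 hsurj hf.1 hrep, esf6_iff_prop2 hsurj hf.1 hrep,
    esf7_iff_prop3 hsurj hf.1 hrep, esf8_iff_prop4 hsurj hf.1 hrep,
    esf8W_iff_prop4' hsurj hf.1 hrep⟩
end

section
/- Suppose 𝒫 has exactly two propositional variables (so 𝒲 has exactly four valuations), and consider the epistemic space in which the set ℰ of epistemic states is the set of nonempty subsets of 𝒲 (i.e., consistent formulas over 𝒫 modulo logical equivalence) and B is the identity. Then no ES basic fusion operator ∇ on this epistemic space whose unique representing basic assignment satisfies the Maximality Condition can satisfy (ESF-SD). -/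
namespace BeliefMerging

variable {W : Type}

theorem rel_of_maxSet_pair_eq_pair {R : W → W → Prop} {a b : W}
    (h : MaxSet {a, b} R = {a, b}) : R a b ∧ R b a := by
  have ha : a ∈ MaxSet {a, b} R := h.symm.subset (by simp)
  have hb : b ∈ MaxSet {a, b} R := h.symm.subset (by simp)
  exact ⟨ha.2 b (by simp), hb.2 a (by simp)⟩

theorem strictRel_of_maxSet_pair_eq_singleton {R : W → W → Prop} {a b : W}
    (hR : ∀ x y, R x y ∨ R y x) (hab : a ≠ b) (h : MaxSet {a, b} R = {a}) :
    StrictRel R a b := by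
  have ha : a ∈ MaxSet {a, b} R := h ▸ Set.mem_singleton a
  refine ⟨ha.2 b (by simp), fun hba => hab ?_⟩
  have hb : b ∈ MaxSet {a, b} R := by
    refine ⟨by simp, ?_⟩
    rintro x (rfl | rfl)
    · exact hba
    · exact (hR x x).elim id id
  rw [h] at hb
  exact hb.symm

/-- If the maximal set of a total preorder on `{a, b, c, d}` is `A`, and `a` lies strictly above
`b` and `c`, then `A` is one of `{a}`, `{a, d}`, `{d}`. -/
theorem eq_of_strictRel_of_eq_maxSet {R : W → W → Prop} {A : Set W} {a b c d : W}
    (hA : A.Nonempty) (hcover : ∀ x, x = a ∨ x = b ∨ x = c ∨ x = d)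
    (hmax : A = MaxSet Set.univ R) (hab : StrictRel R a b) (hac : StrictRel R a c) :
    A = {a} ∨ A = {a, d} ∨ A = {d} := by
  have hb : b ∉ A := fun h => hab.2 ((hmax ▸ h : b ∈ MaxSet Set.univ R).2 a trivial)
  have hc : c ∉ A := fun h => hac.2 ((hmax ▸ h : c ∈ MaxSet Set.univ R).2 a trivial)
  have hsub : A ⊆ {a, d} := by
    intro x hx
    rcases hcover x with rfl | rfl | rfl | rfl <;> simp_all
  rcases Set.subset_pair_iff_eq.1 hsub with h | h | h | h
  · exact absurd h hA.ne_empty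
  · exact Or.inl h
  · exact Or.inr (Or.inr h)
  · exact Or.inr (Or.inl h)

/-- When total preorders on `{a, b, c, d}` are indexed by their maximal sets and the three
preorders with `a` strictly above `b` and `c` all occur on `{a, b, c}`, one of them must be
indexed by `{d}`. -/
theorem strictRel_of_index_singleton
    {R : {A : Set W // A.Nonempty} → W → W → Prop} {a b c d : W}
    (htrans : ∀ A x y z, R A x y → R A y z → R A x z)
    (hmax : ∀ A, A.1 = MaxSet Set.univ (R A))
    (hcover : ∀ x, x = a ∨ x = b ∨ x = c ∨ x = d)
    (hbc : ∃ A, StrictRel (R A) a b ∧ StrictRel (R A) b c)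
    (hcb : ∃ A, StrictRel (R A) a c ∧ StrictRel (R A) c b)
    (heq : ∃ A, StrictRel (R A) a b ∧ R A b c ∧ R A c b) :
    StrictRel (R ⟨{d}, Set.singleton_nonempty d⟩) a b := by
  have strict_trans : ∀ A x y z, StrictRel (R A) x y → R A y z → StrictRel (R A) x z :=
    fun A x y z h h' =>
      ⟨htrans A _ _ _ h.1 h', fun hzx => h.2 (htrans A _ _ _ h' hzx)⟩
  obtain ⟨A₁, h₁, h₁'⟩ := hbc
  obtain ⟨A₂, h₂, h₂'⟩ := hcb
  obtain ⟨A₃, h₃, h₃', h₃''⟩ := heq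
  have hb₂ := strict_trans A₂ _ _ _ h₂ h₂'.1
  have hne₁₂ : A₁.1 ≠ A₂.1 := fun h => by
    obtain rfl := Subtype.ext h
    exact h₁'.2 h₂'.1
  have hne₁₃ : A₁.1 ≠ A₃.1 := fun h => by
    obtain rfl := Subtype.ext h
    exact h₁'.2 h₃''
  have hne₂₃ : A₂.1 ≠ A₃.1 := fun h => by
    obtain rfl := Subtype.ext h
    exact h₂'.2 h₃'
  have key₁ := eq_of_strictRel_of_eq_maxSet A₁.2 hcover (hmax A₁) h₁
    (strict_trans A₁ _ _ _ h₁ h₁'.1)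
  have key₂ := eq_of_strictRel_of_eq_maxSet A₂.2 hcover (hmax A₂) hb₂ h₂
  have key₃ := eq_of_strictRel_of_eq_maxSet A₃.2 hcover (hmax A₃) h₃
    (strict_trans A₃ _ _ _ h₃ h₃')
  have hd : A₁.1 = {d} ∨ A₂.1 = {d} ∨ A₃.1 = {d} := by grind
  have index_eq : ∀ A : {A : Set W // A.Nonempty}, A.1 = {d} → StrictRel (R A) a b →
      StrictRel (R ⟨{d}, Set.singleton_nonempty d⟩) a b := by
    rintro ⟨_, _⟩ rfl h
    exact h
  rcases hd with h | h | h
  · exact index_eq A₁ h h₁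
  · exact index_eq A₂ h hb₂
  · exact index_eq A₃ h h₃

end BeliefMerging

open BeliefMerging in
/-- With exactly two propositional variables (four valuations), on the epistemic
space of consistent formulas (nonempty sets of valuations) with `B` the identity,
no ES basic fusion operator whose representing basic assignment satisfies the
Maximality Condition can satisfy (ESF-SD). -/
theorem no_standard_domain_for_formulas
    {S W : Type} [LinearOrder S] [Nonempty S] [Fintype W]
    (hW : Fintype.card W = 4)
    (nab : Profile S {A : Set W // A.Nonempty} → {A : Set W // A.Nonempty} →
      {A : Set W // A.Nonempty})
    (hbf : BasicFusion (fun E => E.1) nab)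
    (f : Profile S {A : Set W // A.Nonempty} → W → W → Prop)
    (hf : IsBasicAssignment f)
    (hrep : Represents (fun E => E.1) nab f)
    (hmax : Maximality (fun E => E.1) f) :
    ¬ ESFSD (fun E => E.1) nab := by
  intro hSD
  obtain ⟨i⟩ := ‹Nonempty S›
  let R : {A : Set W // A.Nonempty} → W → W → Prop := fun A => f (Profile.single i A)
  have htotal : ∀ A x y, R A x y ∨ R A y x := fun A => (hf.1 _).1
  have htrans : ∀ A x y z, R A x y → R A y z → R A x z := fun A => (hf.1 _).2
  have hstrict : ∀ x y z : W, x ≠ y → x ≠ z → y ≠ z →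
      ∃ A, StrictRel (R A) x y ∧ StrictRel (R A) y z := by
    intro x y z hxy hxz hyz
    obtain ⟨-, -, -, A, h, h'⟩ := hSD i x y z hxy hxz hyz
      ⟨{x, y}, Set.insert_nonempty _ _⟩ ⟨{y, z}, Set.insert_nonempty _ _⟩ rfl rfl
    rw [hrep] at h h'
    exact ⟨A, strictRel_of_maxSet_pair_eq_singleton (htotal A) hxy h,
      strictRel_of_maxSet_pair_eq_singleton (htotal A) hyz h'⟩
  have htie : ∀ x y z : W, x ≠ y → x ≠ z → y ≠ z →
      ∃ A, StrictRel (R A) x y ∧ R A y z ∧ R A z y := by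
    intro x y z hxy hxz hyz
    obtain ⟨-, -, ⟨A, h, h'⟩, -⟩ := hSD i x y z hxy hxz hyz
      ⟨{x, y}, Set.insert_nonempty _ _⟩ ⟨{y, z}, Set.insert_nonempty _ _⟩ rfl rfl
    rw [hrep] at h h'
    exact ⟨A, strictRel_of_maxSet_pair_eq_singleton (htotal A) hxy h,
      rel_of_maxSet_pair_eq_pair h'⟩
  let e : W ≃ Fin 4 := Fintype.equivFinOfCardEq hW
  have hne : ∀ j k : Fin 4, j ≠ k → e.symm j ≠ e.symm k := fun _ _ h => e.symm.injective.ne h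
  have hcover : ∀ x, x = e.symm 0 ∨ x = e.symm 1 ∨ x = e.symm 2 ∨ x = e.symm 3 := by
    intro x
    simp only [e.eq_symm_apply]
    generalize e x = k
    revert k
    decide
  have h01 := hne 0 1 (by decide)
  have h02 := hne 0 2 (by decide)
  have h12 := hne 1 2 (by decide)
  have hab := strictRel_of_index_singleton htrans (hmax i) hcover
    (hstrict _ _ _ h01 h02 h12) (hstrict _ _ _ h02 h01 h12.symm) (htie _ _ _ h01 h02 h12)
  have hba := strictRel_of_index_singleton htrans (hmax i)
    (fun x => or_left_comm.1 (hcover x))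
    (hstrict _ _ _ h01.symm h12 h02) (hstrict _ _ _ h12 h01.symm h02.symm)
    (htie _ _ _ h01.symm h12 h02)
  exact hab.2 hba.1
end

section
/- If an ES combination operator ∇ satisfies (ESF2), (ESF7) and (ESF8), then ∇ satisfies the Unanimity condition (ESF-U). -/
namespace BeliefMerging

theorem Profile.equiv_of_val_eq {S ℰ : Type} [LinearOrder S] {Φ Ψ : Profile S ℰ} {E : ℰ}
    (hcard : Φ.soc.card = Ψ.soc.card) (hΦ : ∀ i, Φ.val i = E) (hΨ : ∀ i, Ψ.val i = E) :
    Profile.Equiv Φ Ψ :=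
  ⟨hcard, fun _ => (hΦ _).trans (hΨ _).symm⟩

/-- Combining a profile with constant value `E₀` gives the same beliefs as combining the
singleton profile of any agent with state `E₀`. -/
theorem belief_eq_single_of_val_eq {S ℰ W : Type} [LinearOrder S]
    {B : ℰ → Set W} (hB : ∀ E : ℰ, (B E).Nonempty) {nab : Profile S ℰ → ℰ → ℰ}
    (h2 : ESF2 B nab) (h7 : ESF7 B nab) (h8 : ESF8 B nab) (Φ : Profile S ℰ) {E₀ : ℰ}
    (hΦ : ∀ i, Φ.val i = E₀) (E : ℰ) (j : S) :
    B (nab Φ E) = B (nab (Profile.single j E₀) E) := by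
  induction hn : Φ.soc.card using Nat.strong_induction_on generalizing Φ with
  | _ n ih =>
    subst hn
    obtain ⟨i, hi⟩ := Φ.soc_nonempty
    obtain hN | hN := (Φ.soc.erase i).eq_empty_or_nonempty
    · refine h2 _ _ _ _ (Profile.equiv_of_val_eq ?_ hΦ fun _ => rfl) rfl
      have hcard := Finset.card_erase_add_one hi
      rw [hN] at hcard
      simpa [Profile.single] using hcard.symm
    · have hs : {i} ⊆ Φ.soc := Finset.singleton_subset_iff.2 hi
      have he : Φ.soc.erase i ⊆ Φ.soc := Finset.erase_subset i Φ.soc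
      have hdisj : Disjoint {i} (Φ.soc.erase i) :=
        Finset.disjoint_singleton_left.2 (Finset.notMem_erase i Φ.soc)
      have hunion : {i} ∪ Φ.soc.erase i = Φ.soc := by
        rw [← Finset.insert_eq, Finset.insert_erase hi]
      have hsingle : B (nab (Φ.restrict {i} (Finset.singleton_nonempty i) hs) E) =
          B (nab (Profile.single j E₀) E) :=
        h2 _ _ _ _ (Profile.equiv_of_val_eq (by simp [Profile.restrict, Profile.single])
          (fun _ => hΦ _) fun _ => rfl) rfl
      have hrest : B (nab (Φ.restrict (Φ.soc.erase i) hN he) E) =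
          B (nab (Profile.single j E₀) E) :=
        ih _ (Finset.card_erase_lt_of_mem hi) _ (fun _ => hΦ _) rfl
      have hsub := h7 Φ _ _ (Finset.singleton_nonempty i) hN hs he hdisj hunion E
      have hsup := h8 Φ _ _ (Finset.singleton_nonempty i) hN hs he hdisj hunion E
      rw [hsingle, hrest, Set.inter_self] at hsub hsup
      exact (hsup (hB _)).antisymm hsub

end BeliefMerging

open BeliefMerging in
/-- (ESF2), (ESF7) and (ESF8) entail the Unanimity condition (ESF-U). -/
theorem unanimity_of_esf2_esf7_esf8
    {S ℰ W : Type} [LinearOrder S] [Nonempty S] [Fintype W] [Nonempty W]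
    (B : ℰ → Set W) (hB : ∀ E : ℰ, (B E).Nonempty)
    (hsurj : ∀ A : Set W, A.Nonempty → ∃ E : ℰ, B E = A)
    (nab : Profile S ℰ → ℰ → ℰ)
    (h2 : ESF2 B nab) (h7 : ESF7 B nab) (h8 : ESF8 B nab) :
    ESFU B nab := by
  intro Φ hΦ E i
  exact belief_eq_single_of_val_eq hB h2 h7 h8 Φ (fun k => hΦ k i) E i.1
end

section
/- Let ∇ be an ES basic fusion operator with unique representing basic assignment Φ ↦ ≽_Φ. The following are equivalent: (i) ∇ satisfies (ESF-U); (ii) for every society N, every N-profile Φ with Φ(i) = Φ(j) for all i, j ∈ N, and every E ∈ ℰ with |[B(E)]| ≤ 2, one has [B(∇(Φ,E))] = [B(∇(Φ(i),E))] for every i ∈ N; (iii) the assignment satisfies property (u): for every society N and every N-profile Φ with Φ(i) = Φ(j) for all i, j ∈ N, one has ≽_Φ = ≽_{Φ(i)} for every i ∈ N. -/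
/-- On a two-element menu, a total relation selects `a` exactly when `a` is weakly above `b`. -/
theorem BeliefMerging.mem_maxSet_pair_s7 {W : Type} {R : W → W → Prop}
    (hR : ∀ a b : W, R a b ∨ R b a) (a b : W) : a ∈ MaxSet {a, b} R ↔ R a b := by
  simp [MaxSet, (hR a a).elim id id]

/-- A total relation is determined by its maximal elements on two-element menus. -/
theorem BeliefMerging.eq_of_maxSet_pair_eq {W : Type} {R R' : W → W → Prop}
    (hR : ∀ a b : W, R a b ∨ R b a) (hR' : ∀ a b : W, R' a b ∨ R' b a)
    (h : ∀ a b : W, MaxSet {a, b} R = MaxSet {a, b} R') : R = R' := by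
  funext a b
  rw [← mem_maxSet_pair_s7 hR, ← mem_maxSet_pair_s7 hR', h]

open BeliefMerging in
/-- Semantic characterization of the Unanimity condition. -/
theorem unanimity_characterization
    {S ℰ W : Type} [LinearOrder S] [Nonempty S] [Fintype W] [Nonempty W]
    (B : ℰ → Set W) (hB : ∀ E : ℰ, (B E).Nonempty)
    (hsurj : ∀ A : Set W, A.Nonempty → ∃ E : ℰ, B E = A)
    (nab : Profile S ℰ → ℰ → ℰ) (hbf : BasicFusion B nab)
    (f : Profile S ℰ → W → W → Prop)
    (hf : IsBasicAssignment f) (hrep : Represents B nab f) :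
    (ESFU B nab ↔
      (∀ Φ : Profile S ℰ, (∀ i j : {x // x ∈ Φ.soc}, Φ.val i = Φ.val j) →
        ∀ E : ℰ, (B E).ncard ≤ 2 → ∀ i : {x // x ∈ Φ.soc},
          B (nab Φ E) = B (nab (Profile.single i.1 (Φ.val i)) E))) ∧
    (ESFU B nab ↔ PropU f) := by
  have propU_of_pairs : (∀ Φ : Profile S ℰ,
      (∀ i j : {x // x ∈ Φ.soc}, Φ.val i = Φ.val j) →
        ∀ E : ℰ, (B E).ncard ≤ 2 → ∀ i : {x // x ∈ Φ.soc},
          B (nab Φ E) = B (nab (Profile.single i.1 (Φ.val i)) E)) → PropU f := by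
    intro h Φ hΦ i
    refine eq_of_maxSet_pair_eq (hf.1 _).1 (hf.1 _).1 fun a b => ?_
    obtain ⟨E, hE⟩ := hsurj {a, b} (Set.insert_nonempty a {b})
    rw [← hE, ← hrep, ← hrep]
    exact h Φ hΦ E (hE ▸ Set.ncard_insert_le a {b} |>.trans (by simp)) i
  have esfu_of_propU : PropU f → ESFU B nab := by
    intro h Φ hΦ E i
    rw [hrep, hrep, h Φ hΦ i]
  have pairs_of_esfu (h : ESFU B nab) (Φ : Profile S ℰ)
      (hΦ : ∀ i j : {x // x ∈ Φ.soc}, Φ.val i = Φ.val j) (E : ℰ) (_ : (B E).ncard ≤ 2)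
      (i : {x // x ∈ Φ.soc}) : B (nab Φ E) = B (nab (Profile.single i.1 (Φ.val i)) E) :=
    h Φ hΦ E i
  exact ⟨⟨pairs_of_esfu, fun h => esfu_of_propU (propU_of_pairs h)⟩,
    ⟨fun h => propU_of_pairs (pairs_of_esfu h), esfu_of_propU⟩⟩
end
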